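/- arXiv:2108.11061 — 7 statements merged into one kernel-verified Lean document; each statement's English description precedes it below -/
import Mathlib

section
/- Let E be a complex inner product space and let A, B : E → E be linear maps such that ⟪A x, y⟫ = ⟪x, B y⟫ for all x, y ∈ E (B is a formal adjoint of A). Then for every u ∈ E and every natural number N, ‖A u‖^(2^(N+1)) ≤ ‖(B ∘ A)^(2^N) u‖ · ‖u‖^(2^(N+1) − 1). -/
open scoped InnerProductSpace

/-- Cauchy–Schwarz for a linear map with a formal adjoint. -/
theorem norm_apply_sq_le_of_formal_adjoint {E : Type*} [NormedAddCommGroup E]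
    [InnerProductSpace ℂ E] {A B : E →ₗ[ℂ] E}
    (hAB : ∀ x y : E, ⟪A x, y⟫_ℂ = ⟪x, B y⟫_ℂ) (u : E) :
    ‖A u‖ ^ 2 ≤ ‖B (A u)‖ * ‖u‖ := by
  have h : ‖⟪A u, A u⟫_ℂ‖ ≤ ‖u‖ * ‖B (A u)‖ := by
    rw [hAB]
    exact norm_inner_le_norm _ _
  rw [inner_self_eq_norm_sq_to_K, norm_pow, RCLike.norm_ofReal, abs_norm] at h
  rwa [mul_comm]

theorem isSymmetric_comp_of_formal_adjoint {E : Type*} [NormedAddCommGroup E]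
    [InnerProductSpace ℂ E] {A B : E →ₗ[ℂ] E}
    (hAB : ∀ x y : E, ⟪A x, y⟫_ℂ = ⟪x, B y⟫_ℂ) : (B ∘ₗ A).IsSymmetric := by
  intro x y
  have hBA : ⟪B (A x), y⟫_ℂ = ⟪A x, A y⟫_ℂ := by
    rw [← inner_conj_symm, ← hAB, inner_conj_symm]
  exact hBA.trans (hAB x (A y))

/-- Iterated Cauchy–Schwarz estimate: if `B` is a formal adjoint of `A` on a complex
inner product space, then `‖A u‖^(2^(N+1)) ≤ ‖(B ∘ A)^(2^N) u‖ * ‖u‖^(2^(N+1) - 1)`. -/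
theorem stmt0 {E : Type*} [NormedAddCommGroup E] [InnerProductSpace ℂ E]
    (A B : E →ₗ[ℂ] E)
    (hAB : ∀ x y : E, ⟪A x, y⟫_ℂ = ⟪x, B y⟫_ℂ) :
    ∀ (u : E) (N : ℕ),
      ‖A u‖ ^ (2 ^ (N + 1)) ≤ ‖((B ∘ₗ A) ^ (2 ^ N)) u‖ * ‖u‖ ^ (2 ^ (N + 1) - 1) := by
  intro u N
  induction N with
  | zero => simpa using norm_apply_sq_le_of_formal_adjoint hAB u
  | succ N ih =>
    set S := (B ∘ₗ A) ^ (2 ^ N) with hS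
    have hsymm : S.IsSymmetric := (isSymmetric_comp_of_formal_adjoint hAB).pow _
    have hSS : ((B ∘ₗ A) ^ (2 ^ (N + 1))) u = S (S u) := by
      rw [pow_succ 2 N, pow_mul, ← hS, sq, Module.End.mul_apply]
    have hexp : 2 ^ (N + 1 + 1) - 1 = 1 + (2 ^ (N + 1) - 1) * 2 := by
      have := Nat.one_le_two_pow (n := N + 1)
      rw [pow_succ 2 (N + 1)]
      omega
    calc ‖A u‖ ^ (2 ^ (N + 1 + 1)) = (‖A u‖ ^ (2 ^ (N + 1))) ^ 2 := by
          rw [pow_succ 2 (N + 1), pow_mul]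
      _ ≤ (‖S u‖ * ‖u‖ ^ (2 ^ (N + 1) - 1)) ^ 2 := by gcongr
      _ = ‖S u‖ ^ 2 * ‖u‖ ^ ((2 ^ (N + 1) - 1) * 2) := by rw [mul_pow, ← pow_mul]
      _ ≤ ‖S (S u)‖ * ‖u‖ * ‖u‖ ^ ((2 ^ (N + 1) - 1) * 2) := by
          gcongr
          exact norm_apply_sq_le_of_formal_adjoint hsymm u
      _ = ‖((B ∘ₗ A) ^ (2 ^ (N + 1))) u‖ * ‖u‖ ^ (2 ^ (N + 1 + 1) - 1) := by
          rw [hSS, hexp, pow_add ‖u‖, pow_one, mul_assoc]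
end

section
/- Let E be a complex inner product space and let A, B : E → E be linear maps such that ⟪A x, y⟫ = ⟪x, B y⟫ for all x, y ∈ E (B is a formal adjoint of A). If there exist a real number C ≥ 0 and a natural number N such that ‖(B ∘ A)^(2^N) u‖ ≤ C · ‖u‖ for all u ∈ E, then ‖A u‖ ≤ C^(2^(−(N+1))) · ‖u‖ for all u ∈ E; in particular A is a bounded linear map. -/
open scoped InnerProductSpace

/-- A formal adjoint pair satisfies `‖A u‖ ≤ √C ‖u‖` as soon as `‖B (A u)‖ ≤ C ‖u‖`. -/
theorem norm_le_sqrt_mul_of_formal_adjoint {E : Type*} [NormedAddCommGroup E]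
    [InnerProductSpace ℂ E] {A B : E →ₗ[ℂ] E} (hAB : ∀ x y : E, ⟪A x, y⟫_ℂ = ⟪x, B y⟫_ℂ)
    {C : ℝ} {u : E} (hu : ‖B (A u)‖ ≤ C * ‖u‖) : ‖A u‖ ≤ √C * ‖u‖ := by
  have h : ‖A u‖ ^ 2 ≤ C * ‖u‖ ^ 2 := calc
    ‖A u‖ ^ 2 = ‖⟪A u, A u⟫_ℂ‖ := by rw [inner_self_eq_norm_sq_to_K]; simp
    _ = ‖⟪u, B (A u)⟫_ℂ‖ := by rw [hAB]
    _ ≤ ‖u‖ * ‖B (A u)‖ := norm_inner_le_norm _ _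
    _ ≤ ‖u‖ * (C * ‖u‖) := by gcongr
    _ = C * ‖u‖ ^ 2 := by ring
  calc ‖A u‖ ≤ √(C * ‖u‖ ^ 2) := Real.le_sqrt_of_sq_le h
    _ = √C * ‖u‖ := by rw [Real.sqrt_mul' _ (sq_nonneg _), Real.sqrt_sq (norm_nonneg _)]

/-- Iterated Cauchy–Schwarz estimate for symmetric operators. -/
theorem LinearMap.IsSymmetric.norm_le_rpow_mul_of_pow_two_pow {E : Type*} [NormedAddCommGroup E]
    [InnerProductSpace ℂ E] {T : E →ₗ[ℂ] E} (hT : T.IsSymmetric) (N : ℕ) {C : ℝ} (hC : 0 ≤ C)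
    (hbound : ∀ u : E, ‖(T ^ (2 ^ N)) u‖ ≤ C * ‖u‖) (u : E) :
    ‖T u‖ ≤ C ^ ((2 : ℝ) ^ (-(N : ℝ))) * ‖u‖ := by
  induction N generalizing C with
  | zero => simpa using hbound u
  | succ N ih =>
    have h := ih (Real.sqrt_nonneg C) fun v =>
      norm_le_sqrt_mul_of_formal_adjoint (hT.pow (2 ^ N)) <| by
        simpa only [pow_succ, mul_two, pow_add, Module.End.mul_apply] using hbound v
    rwa [Real.sqrt_eq_rpow, ← Real.rpow_mul hC, one_div, ← Real.rpow_neg_one,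
      ← Real.rpow_add two_pos, ← neg_add, add_comm, ← Nat.cast_succ] at h

/-- If `B` is a formal adjoint of `A` on a complex inner product space and
`‖(B ∘ A)^(2^N) u‖ ≤ C ‖u‖` for all `u`, then `‖A u‖ ≤ C^(2^(-(N+1))) ‖u‖` for all `u`;
in particular `A` is bounded. -/
theorem stmt1 {E : Type*} [NormedAddCommGroup E] [InnerProductSpace ℂ E]
    (A B : E →ₗ[ℂ] E)
    (hAB : ∀ x y : E, ⟪A x, y⟫_ℂ = ⟪x, B y⟫_ℂ)
    (C : ℝ) (hC : 0 ≤ C) (N : ℕ)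
    (hbound : ∀ u : E, ‖((B ∘ₗ A) ^ (2 ^ N)) u‖ ≤ C * ‖u‖) :
    ∀ u : E, ‖A u‖ ≤ C ^ ((2 : ℝ) ^ (-((N : ℝ) + 1))) * ‖u‖ := by
  intro u
  have h := norm_le_sqrt_mul_of_formal_adjoint hAB
    ((isSymmetric_comp_of_formal_adjoint hAB).norm_le_rpow_mul_of_pow_two_pow N hC hbound u)
  rwa [Real.sqrt_eq_rpow, ← Real.rpow_mul hC, one_div, ← Real.rpow_neg_one,
    ← Real.rpow_add two_pos, ← neg_add] at h
end

section
/- In the filtered symbol calculus setting, suppose in addition that for all m, m' ∈ ℕ and every j ∈ ℕ there are ℂ-bilinear maps C_j : V_m × V_{m'} → V_{m+m'+j} such that for all a ∈ V_m, b ∈ V_{m'} and all N ∈ ℕ, T(a)·T(b) − ∑_{j=0}^{N} T(C_j(a,b)) ∈ I_{m+m'+N+1}. Then for all m, m', m'' ∈ ℕ, all a ∈ V_m, b ∈ V_{m'}, c ∈ V_{m''} and every k ∈ ℕ, ∑_{l=0}^{k} C_l(a, C_{k−l}(b,c)) = ∑_{l=0}^{k} C_l(C_{k−l}(a,b), c);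 that is, the formal star product a*b = ∑_{j} C_j(a,b) ν^{−j} defined by the coefficient maps C_j is associative. -/
/-- Transport an element of `V i` to `V j` along an equality `i = j` of indices. -/
def castSymb {V : ℕ → Type*} {i : ℕ} (x : V i) (j : ℕ) (h : i = j) : V j := h ▸ x

theorem map_castSymb {B : Type*} {V : ℕ → Type*} (T : ∀ m, V m → B) {i j : ℕ}
    (x : V i) (h : i = j) : T j (castSymb x j h) = T i x := by
  subst h
  rfl

/-- Two formal expansions of the same element have the same coefficients. -/
theorem coeff_eq_of_expansions {B : Type*} [Ring B] [Algebra ℂ B]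
    {I : ℕ → Submodule ℂ B} {V : ℕ → Type*} [∀ m, AddCommGroup (V m)] [∀ m, Module ℂ (V m)]
    {T : ∀ m, V m →ₗ[ℂ] B} (hTinj : ∀ m (a : V m), T m a ∈ I (m + 1) → a = 0)
    {M : ℕ} {x : B} {u v : ∀ k, V (M + k)}
    (hu : ∀ N, x - ∑ k ∈ Finset.range (N + 1), T (M + k) (u k) ∈ I (M + N + 1))
    (hv : ∀ N, x - ∑ k ∈ Finset.range (N + 1), T (M + k) (v k) ∈ I (M + N + 1)) (k : ℕ) :
    u k = v k := by
  induction k using Nat.strong_induction_on with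
  | _ k ih =>
    refine sub_eq_zero.mp (hTinj _ _ ?_)
    have hlt : ∑ j ∈ Finset.range k, T (M + j) (u j) = ∑ j ∈ Finset.range k, T (M + j) (v j) :=
      Finset.sum_congr rfl fun j hj => by rw [ih j (Finset.mem_range.mp hj)]
    have h := sub_mem (hv k) (hu k)
    rw [Finset.sum_range_succ, Finset.sum_range_succ, hlt] at h
    rw [map_sub]
    convert h using 1
    abel

/-- Composing an expansion `x ∼ ∑ u j` with expansions `φ (u j) ∼ ∑ f l j`. -/
theorem sub_sum_antidiagonal_mem {B : Type*} [AddCommGroup B] {S : Type*} [SetLike S B]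
    [AddSubgroupClass S B] (J : S) (φ : B →+ B) (x : B) (u : ℕ → B) (f : ℕ → ℕ → B) (N : ℕ)
    (hx : φ (x - ∑ j ∈ Finset.range (N + 1), u j) ∈ J)
    (hf : ∀ j ≤ N, φ (u j) - ∑ l ∈ Finset.range (N - j + 1), f l j ∈ J) :
    φ x - ∑ k ∈ Finset.range (N + 1), ∑ l ∈ Finset.range (k + 1), f l (k - l) ∈ J := by
  have hflip : ∑ k ∈ Finset.range (N + 1), ∑ l ∈ Finset.range (k + 1), f l (k - l) =
      ∑ j ∈ Finset.range (N + 1), ∑ l ∈ Finset.range (N - j + 1), f l j := by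
    calc
      _ = ∑ k ∈ Finset.range (N + 1), ∑ j ∈ Finset.range (k + 1), f (k - j) j := by
        refine Finset.sum_congr rfl fun k _ => ?_
        rw [← Finset.sum_flip]
        refine Finset.sum_congr rfl fun j hj => ?_
        rw [Nat.sub_sub_self (Nat.lt_succ_iff.mp (Finset.mem_range.mp hj))]
      _ = ∑ j ∈ Finset.range (N + 1), ∑ l ∈ Finset.range (N + 1 - j), f l j :=
        Finset.sum_range_diag_flip (N + 1) fun j l => f l j
      _ = _ := by
        refine Finset.sum_congr rfl fun j hj => ?_
        rw [Nat.succ_sub (Nat.lt_succ_iff.mp (Finset.mem_range.mp hj))]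
  have h := add_mem hx (sum_mem (t := Finset.range (N + 1)) fun j hj =>
    hf j (Nat.lt_succ_iff.mp (Finset.mem_range.mp hj)))
  rw [map_sub, map_sum, Finset.sum_sub_distrib, sub_add_sub_cancel] at h
  rwa [hflip]

/-- Filtered symbol calculus: if the quantization `T` admits a symbolic expansion of
products with bilinear coefficient maps `C_j`, then the coefficients satisfy the
associativity identities `∑_{l=0}^{k} C_l(a, C_{k-l}(b,c)) = ∑_{l=0}^{k} C_l(C_{k-l}(a,b), c)`,
i.e. the formal star product `a*b = ∑_j C_j(a,b) ν^{-j}` is associative. -/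
theorem stmt3 {B : Type*} [Ring B] [Algebra ℂ B]
    (I : ℕ → Submodule ℂ B)
    (hdec : ∀ p, I (p + 1) ≤ I p)
    (hmul : ∀ p q : ℕ, ∀ x ∈ I p, ∀ y ∈ I q, x * y ∈ I (p + q))
    (V : ℕ → Type*) [∀ m, AddCommGroup (V m)] [∀ m, Module ℂ (V m)]
    (T : ∀ m, V m →ₗ[ℂ] B)
    (hTmem : ∀ m (a : V m), T m a ∈ I m)
    (hTinj : ∀ m (a : V m), T m a ∈ I (m + 1) → a = 0)
    (C : ∀ m m' j, V m →ₗ[ℂ] V m' →ₗ[ℂ] V (m + m' + j))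
    (hexp : ∀ (m m' : ℕ) (a : V m) (b : V m') (N : ℕ),
      T m a * T m' b - ∑ j ∈ Finset.range (N + 1), T (m + m' + j) (C m m' j a b)
        ∈ I (m + m' + N + 1)) :
    ∀ (m m' m'' : ℕ) (a : V m) (b : V m') (c : V m'') (k : ℕ),
      (∑ l ∈ (Finset.range (k + 1)).attach,
          castSymb (V := V)
            (C m (m' + m'' + (k - l.1)) l.1 a (C m' m'' (k - l.1) b c))
            (m + m' + m'' + k)
            (by have := Finset.mem_range.mp l.2; omega)) =
      (∑ l ∈ (Finset.range (k + 1)).attach,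
          castSymb (V := V)
            (C (m + m' + (k - l.1)) m'' l.1 (C m m' (k - l.1) a b) c)
            (m + m' + m'' + k)
            (by have := Finset.mem_range.mp l.2; omega)) := by
  intro m m' m'' a b c k
  refine coeff_eq_of_expansions (I := I) (T := T) hTinj (M := m + m' + m'')
    (x := T m a * T m' b * T m'' c)
    (u := fun k => ∑ l ∈ (Finset.range (k + 1)).attach, castSymb (V := V)
      (C m (m' + m'' + (k - l.1)) l.1 a (C m' m'' (k - l.1) b c)) (m + m' + m'' + k)
      (by have := Finset.mem_range.mp l.2; omega))
    (v := fun k => ∑ l ∈ (Finset.range (k + 1)).attach, castSymb (V := V)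
      (C (m + m' + (k - l.1)) m'' l.1 (C m m' (k - l.1) a b) c) (m + m' + m'' + k)
      (by have := Finset.mem_range.mp l.2; omega))
    (fun N => ?_) (fun N => ?_) k
  · have h := sub_sum_antidiagonal_mem (I (m + m' + m'' + N + 1)) (AddMonoidHom.mulLeft (T m a))
      (T m' b * T m'' c) (fun j => T _ (C m' m'' j b c))
      (fun l j => T _ (C m (m' + m'' + j) l a (C m' m'' j b c))) N
      (by
        have h := hmul _ _ _ (hTmem m a) _ (hexp m' m'' b c N)
        rwa [show m + (m' + m'' + N + 1) = m + m' + m'' + N + 1 by omega] at h)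
      (fun j hj => by
        have h := hexp m (m' + m'' + j) a (C m' m'' j b c) (N - j)
        rwa [show m + (m' + m'' + j) + (N - j) + 1 = m + m' + m'' + N + 1 by omega] at h)
    simp only [map_sum, map_castSymb (fun i => T i)]
    simp only [AddMonoidHom.coe_mulLeft, ← mul_assoc] at h
    convert h using 4 with n hn
    exact Finset.sum_attach (Finset.range (n + 1))
      fun l => T _ (C m (m' + m'' + (n - l)) l a (C m' m'' (n - l) b c))
  · have h := sub_sum_antidiagonal_mem (I (m + m' + m'' + N + 1)) (AddMonoidHom.mulRight (T m'' c))
      (T m a * T m' b) (fun j => T _ (C m m' j a b))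
      (fun l j => T _ (C (m + m' + j) m'' l (C m m' j a b) c)) N
      (by
        have h := hmul _ _ _ (hexp m m' a b N) _ (hTmem m'' c)
        rwa [show m + m' + N + 1 + m'' = m + m' + m'' + N + 1 by omega] at h)
      (fun j hj => by
        have h := hexp (m + m' + j) m'' (C m m' j a b) c (N - j)
        rwa [show m + m' + j + m'' + (N - j) + 1 = m + m' + m'' + N + 1 by omega] at h)
    simp only [map_sum, map_castSymb (fun i => T i)]
    simp only [AddMonoidHom.mulRight_apply] at h
    convert h using 4 with n hn
    exact Finset.sum_attach (Finset.range (n + 1))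
      fun l => T _ (C (m + m' + (n - l)) m'' l (C m m' (n - l) a b) c)
end

section
/- In the filtered symbol calculus setting, suppose in addition the symbol-surjectivity condition: for every p ∈ ℕ and every E ∈ I_p there exists c ∈ V_p with E − T(c) ∈ I_{p+1}. Then for all m, m' ∈ ℕ there exists a unique family of maps C_j : V_m × V_{m'} → V_{m+m'+j} (j ∈ ℕ) such that for all a ∈ V_m, b ∈ V_{m'} and all N ∈ ℕ, T(a)·T(b) − ∑_{j=0}^{N} T(C_j(a,b)) ∈ I_{m+m'+N+1}; moreover each C_j is automatically ℂ-bilinear. -/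
/-- The sequence of symbols `c` is an asymptotic expansion of `E`, starting at order `k`. -/
def IsSymbolExpansion {B : Type*} [Ring B] [Algebra ℂ B] (I : ℕ → Submodule ℂ B)
    {V : ℕ → Type*} [∀ m, AddCommGroup (V m)] [∀ m, Module ℂ (V m)]
    (T : ∀ m, V m →ₗ[ℂ] B) (k : ℕ) (E : B) (c : ∀ j, V (k + j)) : Prop :=
  ∀ N : ℕ, E - ∑ j ∈ Finset.range (N + 1), T (k + j) (c j) ∈ I (k + N + 1)

namespace IsSymbolExpansion

variable {B : Type*} [Ring B] [Algebra ℂ B] {I : ℕ → Submodule ℂ B}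
  {V : ℕ → Type*} [∀ m, AddCommGroup (V m)] [∀ m, Module ℂ (V m)]
  {T : ∀ m, V m →ₗ[ℂ] B} {k : ℕ} {E E' : B} {c c' : ∀ j, V (k + j)}

theorem add (h : IsSymbolExpansion I T k E c) (h' : IsSymbolExpansion I T k E' c') :
    IsSymbolExpansion I T k (E + E') (fun j => c j + c' j) := by
  intro N
  simp only [map_add, Finset.sum_add_distrib, add_sub_add_comm]
  exact (I _).add_mem (h N) (h' N)

theorem smul (r : ℂ) (h : IsSymbolExpansion I T k E c) :
    IsSymbolExpansion I T k (r • E) (fun j => r • c j) := by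
  intro N
  simp only [map_smul, ← Finset.smul_sum, ← smul_sub]
  exact (I _).smul_mem r (h N)

theorem unique (hTinj : ∀ m (a : V m), T m a ∈ I (m + 1) → a = 0)
    (h : IsSymbolExpansion I T k E c) (h' : IsSymbolExpansion I T k E c') : c = c' := by
  funext n
  induction n using Nat.strong_induction_on with
  | _ n ih =>
    refine sub_eq_zero.mp (hTinj _ _ ?_)
    have hsum : ∑ j ∈ Finset.range n, T (k + j) (c j) =
        ∑ j ∈ Finset.range n, T (k + j) (c' j) :=
      Finset.sum_congr rfl fun j hj => by rw [ih j (Finset.mem_range.mp hj)]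
    have hdiff := (I _).sub_mem (h' n) (h n)
    rw [Finset.sum_range_succ, Finset.sum_range_succ, hsum] at hdiff
    rw [map_sub]
    convert hdiff using 1
    abel

theorem exists_of_mem (hTsurj : ∀ p : ℕ, ∀ E ∈ I p, ∃ c : V p, E - T p c ∈ I (p + 1))
    (hE : E ∈ I k) : ∃ c : ∀ j, V (k + j), IsSymbolExpansion I T k E c := by
  choose! s hs using hTsurj
  let R : ℕ → B := fun n => Nat.rec E (fun i x => x - T (k + i) (s (k + i) x)) n
  have hR : ∀ n, R n ∈ I (k + n) := by
    intro n
    induction n with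
    | zero => exact hE
    | succ n ih => exact hs (k + n) (R n) ih
  have hsum : ∀ n, E - ∑ j ∈ Finset.range n, T (k + j) (s (k + j) (R j)) = R n := by
    intro n
    induction n with
    | zero => simp [R]
    | succ n ih => rw [Finset.sum_range_succ, ← sub_sub, ih]
  exact ⟨fun j => s (k + j) (R j), fun N => (hsum (N + 1)).symm ▸ hR (N + 1)⟩

end IsSymbolExpansion

/-- Filtered symbol calculus with the symbol-surjectivity condition: there exists a
unique family of coefficient maps `C_j : V_m → V_{m'} → V_{m+m'+j}` giving the symbolic
expansion of products `T(a)·T(b) ∼ ∑_j T(C_j(a,b))`, and each `C_j` is automatically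
`ℂ`-bilinear. -/
theorem stmt4 {B : Type*} [Ring B] [Algebra ℂ B]
    (I : ℕ → Submodule ℂ B)
    (hdec : ∀ p, I (p + 1) ≤ I p)
    (hmul : ∀ p q : ℕ, ∀ x ∈ I p, ∀ y ∈ I q, x * y ∈ I (p + q))
    (V : ℕ → Type*) [∀ m, AddCommGroup (V m)] [∀ m, Module ℂ (V m)]
    (T : ∀ m, V m →ₗ[ℂ] B)
    (hTmem : ∀ m (a : V m), T m a ∈ I m)
    (hTinj : ∀ m (a : V m), T m a ∈ I (m + 1) → a = 0)
    (hTsurj : ∀ p : ℕ, ∀ E ∈ I p, ∃ c : V p, E - T p c ∈ I (p + 1)) :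
    ∀ m m' : ℕ, ∃ C : ∀ j : ℕ, V m → V m' → V (m + m' + j),
      ((∀ (a : V m) (b : V m') (N : ℕ),
          T m a * T m' b - ∑ j ∈ Finset.range (N + 1), T (m + m' + j) (C j a b)
            ∈ I (m + m' + N + 1)) ∧
        (∀ (j : ℕ) (a a' : V m) (b : V m'), C j (a + a') b = C j a b + C j a' b) ∧
        (∀ (j : ℕ) (r : ℂ) (a : V m) (b : V m'), C j (r • a) b = r • C j a b) ∧
        (∀ (j : ℕ) (a : V m) (b b' : V m'), C j a (b + b') = C j a b + C j a b') ∧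
        (∀ (j : ℕ) (r : ℂ) (a : V m) (b : V m'), C j a (r • b) = r • C j a b)) ∧
      ∀ C' : ∀ j : ℕ, V m → V m' → V (m + m' + j),
        (∀ (a : V m) (b : V m') (N : ℕ),
          T m a * T m' b - ∑ j ∈ Finset.range (N + 1), T (m + m' + j) (C' j a b)
            ∈ I (m + m' + N + 1)) → C' = C := by
  intro m m'
  have hex : ∀ (a : V m) (b : V m'), ∃ c : ∀ j, V (m + m' + j),
      IsSymbolExpansion I T (m + m') (T m a * T m' b) c := fun a b =>
    IsSymbolExpansion.exists_of_mem hTsurj (hmul m m' _ (hTmem m a) _ (hTmem m' b))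
  choose c hc using hex
  refine ⟨fun j a b => c a b j, ⟨hc, fun j a a' b => ?_, fun j r a b => ?_,
    fun j a b b' => ?_, fun j r a b => ?_⟩, fun C' hC' => ?_⟩
  · have h := (hc a b).add (hc a' b)
    rw [← add_mul, ← map_add] at h
    exact congrFun (IsSymbolExpansion.unique hTinj (hc (a + a') b) h) j
  · have h := (hc a b).smul r
    rw [← smul_mul_assoc, ← map_smul] at h
    exact congrFun (IsSymbolExpansion.unique hTinj (hc (r • a) b) h) j
  · have h := (hc a b).add (hc a b')
    rw [← mul_add, ← map_add] at h
    exact congrFun (IsSymbolExpansion.unique hTinj (hc a (b + b')) h) j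
  · have h := (hc a b).smul r
    rw [← mul_smul_comm, ← map_smul] at h
    exact congrFun (IsSymbolExpansion.unique hTinj (hc a (r • b)) h) j
  · funext j a b
    exact congrFun (IsSymbolExpansion.unique hTinj (hC' a b) (hc a b)) j
end

section
/- Let n ≥ 1, k ≥ 0, let q ∈ {0, 1, …, n}, and let g : ℂⁿ × ℂⁿ × ℝ^k → ℂ be a smooth function of the underlying 4n + k real variables, written g(z, w, t) with z = (z_1,…,z_n), w = (w_1,…,w_n). Suppose that: (i) for each j with 1 ≤ j ≤ q, the Wirtinger derivatives ∂g/∂z_j and ∂g/∂w̄_j vanish to infinite order at the origin; (ii) for each j with q+1 ≤ j ≤ n, the Wirtinger derivatives ∂g/∂z̄_j and ∂g/∂w_j vanish to infinite order at the origin; (iii) g(z, z, t) = 0 for all (z, t) in a neighborhood of the origin of ℂⁿ × ℝ^k. Then g vanishes to infinite order at the origin, i.e. every iterated partial derivative of g (of every order, with respect to the 4n + k real coordinates) vanishes at the origin. -/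
open Filter

/-- The domain `ℂⁿ × ℂⁿ × ℝᵏ`, viewed as a real normed space. -/
abbrev Dom (n k : ℕ) : Type := (Fin n → ℂ) × (Fin n → ℂ) × (Fin k → ℝ)

/-- Wirtinger derivative `∂g/∂z_j = (1/2)(∂g/∂x_{2j-1} − i ∂g/∂x_{2j})` in the first
group of complex variables. -/
noncomputable def dz {n k : ℕ} (g : Dom n k → ℂ) (j : Fin n) (p : Dom n k) : ℂ :=
  (1 / 2) * (fderiv ℝ g p (Pi.single j 1, 0, 0) -
    Complex.I * fderiv ℝ g p (Pi.single j Complex.I, 0, 0))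

/-- Wirtinger derivative `∂g/∂z̄_j = (1/2)(∂g/∂x_{2j-1} + i ∂g/∂x_{2j})` in the first
group of complex variables. -/
noncomputable def dzbar {n k : ℕ} (g : Dom n k → ℂ) (j : Fin n) (p : Dom n k) : ℂ :=
  (1 / 2) * (fderiv ℝ g p (Pi.single j 1, 0, 0) +
    Complex.I * fderiv ℝ g p (Pi.single j Complex.I, 0, 0))

/-- Wirtinger derivative `∂g/∂w_j` in the second group of complex variables. -/
noncomputable def dw {n k : ℕ} (g : Dom n k → ℂ) (j : Fin n) (p : Dom n k) : ℂ :=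
  (1 / 2) * (fderiv ℝ g p (0, Pi.single j 1, 0) -
    Complex.I * fderiv ℝ g p (0, Pi.single j Complex.I, 0))

/-- Wirtinger derivative `∂g/∂w̄_j` in the second group of complex variables. -/
noncomputable def dwbar {n k : ℕ} (g : Dom n k → ℂ) (j : Fin n) (p : Dom n k) : ℂ :=
  (1 / 2) * (fderiv ℝ g p (0, Pi.single j 1, 0) +
    Complex.I * fderiv ℝ g p (0, Pi.single j Complex.I, 0))

/-- A function vanishes to infinite order at a point if all its iterated derivatives
(of every order) vanish there. -/
def FlatAt {E F : Type*} [NormedAddCommGroup E] [NormedSpace ℝ E]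
    [NormedAddCommGroup F] [NormedSpace ℝ F] (f : E → F) (p : E) : Prop :=
  ∀ N : ℕ, iteratedFDeriv ℝ N f p = 0

section FlatFunctions

variable {E F G : Type*} [NormedAddCommGroup E] [NormedSpace ℝ E]
  [NormedAddCommGroup F] [NormedSpace ℝ F] [NormedAddCommGroup G] [NormedSpace ℝ G]

lemma FlatAt.add {f g : E → F} {p : E} (hf : ContDiff ℝ (⊤ : ℕ∞) f)
    (hg : ContDiff ℝ (⊤ : ℕ∞) g) (h₁ : FlatAt f p) (h₂ : FlatAt g p) :
    FlatAt (fun x => f x + g x) p := by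
  intro N
  have := iteratedFDeriv_add_apply (i := N) (x := p)
    ((hf.of_le (mod_cast le_top)).contDiffAt) ((hg.of_le (mod_cast le_top)).contDiffAt)
  have h : (fun x => f x + g x) = f + g := rfl
  rw [h, this, h₁ N, h₂ N, add_zero]

lemma FlatAt.clm_comp {f : E → F} {p : E} (hf : ContDiff ℝ (⊤ : ℕ∞) f) (h : FlatAt f p)
    (L : F →L[ℝ] G) : FlatAt (fun x => L (f x)) p := by
  intro N
  have := L.iteratedFDeriv_comp_left (i := N) (x := p) (n := N)
    ((hf.of_le (mod_cast le_top)).contDiffAt) le_rfl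
  have h' : (fun x => L (f x)) = L ∘ f := rfl
  rw [h', this, h N]
  ext m
  simp

lemma FlatAt.const_mul {f : E → ℂ} {p : E} (hf : ContDiff ℝ (⊤ : ℕ∞) f) (h : FlatAt f p)
    (c : ℂ) : FlatAt (fun x => c * f x) p :=
  h.clm_comp hf (ContinuousLinearMap.mul ℝ ℂ c)

lemma FlatAt.apply_eq_zero {f : E → F} {p : E} (h : FlatAt f p) : f p = 0 := by
  have := congrArg (fun m => m (0 : Fin 0 → E)) (h 0)
  simpa using this

lemma FlatAt.fderiv {f : E → F} {p : E} (h : FlatAt f p) : FlatAt (fderiv ℝ f) p := by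
  intro N
  ext m v
  have := congrArg (fun M => M (Fin.snoc m v : Fin (N + 1) → E)) (h (N + 1))
  simpa [iteratedFDeriv_succ_apply_right] using this

lemma contDiff_fderiv_of_smooth {f : E → F} (hf : ContDiff ℝ (⊤ : ℕ∞) f) :
    ContDiff ℝ (⊤ : ℕ∞) (fderiv ℝ f) :=
  hf.fderiv_right (by simp)

/-- A class of smooth functions that vanish at `p` and that is stable under directional
derivatives consists of functions that are flat at `p`. -/
lemma flatAt_of_stable {p : E} (C : (E → F) → Prop)
    (smooth : ∀ f, C f → ContDiff ℝ (⊤ : ℕ∞) f) (zero : ∀ f, C f → f p = 0)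
    (stable : ∀ f, C f → ∀ v, C (fun x => fderiv ℝ f x v)) {f : E → F} (hf : C f) :
    FlatAt f p := by
  intro N
  induction N generalizing f with
  | zero =>
    ext m
    simp [zero f hf]
  | succ N ih =>
    ext m
    have := (ContinuousLinearMap.apply ℝ F (m (Fin.last N))).iteratedFDeriv_comp_left
      (i := N) (x := p) (n := N)
      (((contDiff_fderiv_of_smooth (smooth f hf)).of_le (mod_cast le_top)).contDiffAt) le_rfl
    have h' : (ContinuousLinearMap.apply ℝ F (m (Fin.last N))) ∘ fderiv ℝ f
      = fun x => fderiv ℝ f x (m (Fin.last N)) := rfl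
    rw [h', ih (stable f hf _)] at this
    have := congrArg (fun M => M (Fin.init m)) this
    simpa [iteratedFDeriv_succ_apply_right] using this.symm

/-- The derivative of `f` along the complexified vector `a + i b`. -/
noncomputable def cderiv (f : E → ℂ) (a b : E) (p : E) : ℂ :=
  fderiv ℝ f p a + Complex.I * fderiv ℝ f p b

lemma contDiff_cderiv {f : E → ℂ} (hf : ContDiff ℝ (⊤ : ℕ∞) f) (a b : E) :
    ContDiff ℝ (⊤ : ℕ∞) (cderiv f a b) := by
  have := contDiff_fderiv_of_smooth hf
  unfold cderiv
  fun_prop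

lemma FlatAt.cderiv {f : E → ℂ} {p : E} (hf : ContDiff ℝ (⊤ : ℕ∞) f) (h : FlatAt f p)
    (a b : E) : FlatAt (cderiv f a b) p := by
  have hs := contDiff_fderiv_of_smooth hf
  exact (h.fderiv.clm_comp hs (ContinuousLinearMap.apply ℝ ℂ a)).add (by fun_prop)
    (by fun_prop) ((h.fderiv.clm_comp hs (ContinuousLinearMap.apply ℝ ℂ b)).const_mul
      (by fun_prop) Complex.I)

lemma flatAt_cderiv_zero (f : E → ℂ) (p : E) : FlatAt (cderiv f 0 0) p := by
  intro N
  have : cderiv f 0 0 = fun _ => 0 := by funext; simp [cderiv]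
  rw [this]
  simp

lemma fderiv_cderiv {f : E → ℂ} (hf : ContDiff ℝ (⊤ : ℕ∞) f) (a b p v : E) :
    fderiv ℝ (cderiv f a b) p v =
      fderiv ℝ (fderiv ℝ f) p v a + Complex.I * fderiv ℝ (fderiv ℝ f) p v b := by
  have hd : DifferentiableAt ℝ (fderiv ℝ f) p :=
    (contDiff_fderiv_of_smooth hf).differentiable (by simp) p
  have h (u : E) : HasFDerivAt (fun x => fderiv ℝ f x u)
      ((ContinuousLinearMap.apply ℝ ℂ u).comp (fderiv ℝ (fderiv ℝ f) p)) p :=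
    (ContinuousLinearMap.apply ℝ ℂ u).hasFDerivAt.comp p hd.hasFDerivAt
  have := ((h a).add ((h b).const_mul Complex.I)).fderiv
  change fderiv ℝ ((fun x => fderiv ℝ f x a) + fun x => Complex.I * fderiv ℝ f x b) p v = _
  rw [this]
  simp

lemma cderiv_comm {f : E → ℂ} (hf : ContDiff ℝ (⊤ : ℕ∞) f) (a b c d : E) :
    cderiv (cderiv f a b) c d = cderiv (cderiv f c d) a b := by
  funext p
  have hs : IsSymmSndFDerivAt ℝ f p := hf.contDiffAt.isSymmSndFDerivAt
    (by rw [minSmoothness_of_isRCLikeNormedField]; exact WithTop.coe_le_coe.2 (le_top : (2 : ℕ∞) ≤ ⊤))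
  simp only [cderiv, fderiv_cderiv hf]
  rw [hs.eq c a, hs.eq c b, hs.eq d a, hs.eq d b]
  ring

/-- If `f` vanishes near `0` in a subspace `T`, so do its derivatives along `T`. -/
lemma eventually_cderiv_eq_zero {f : E → ℂ} (hf : ContDiff ℝ (⊤ : ℕ∞) f) {T : Submodule ℝ E}
    (h : ∀ᶠ p in nhdsWithin 0 (T : Set E), f p = 0) {a b : E} (ha : a ∈ T) (hb : b ∈ T) :
    ∀ᶠ p in nhdsWithin 0 (T : Set E), cderiv f a b p = 0 := by
  filter_upwards [eventually_eventually_nhdsWithin.2 h, self_mem_nhdsWithin] with p hp hpT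
  have key (u : E) (hu : u ∈ T) : fderiv ℝ f p u = 0 := by
    have ht : Tendsto (fun t : ℝ => p + t • u) (nhds 0) (nhdsWithin p (T : Set E)) := by
      refine tendsto_nhdsWithin_iff.2 ⟨?_, Eventually.of_forall fun t =>
        T.add_mem hpT (T.smul_mem t hu)⟩
      have : Continuous fun t : ℝ => p + t • u := by fun_prop
      simpa using this.tendsto 0
    have hz : (fun t : ℝ => f (p + t • u)) =ᶠ[nhds 0] fun _ => 0 := ht.eventually hp
    rw [← (hf.differentiable (by simp) p).lineDeriv_eq_fderiv, lineDeriv, hz.deriv_eq]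
    simp
  simp [cderiv, key a ha, key b hb]

/-- A smooth function vanishing near `0` in a subspace `T` is flat at `0` as soon as all its
directional derivatives agree, up to flat functions, with complex derivatives along `T`. -/
lemma flatAt_of_tangential {g : E → ℂ} (hg : ContDiff ℝ (⊤ : ℕ∞) g) (T : Submodule ℝ E)
    (hT : ∀ᶠ p in nhdsWithin 0 (T : Set E), g p = 0)
    (htan : ∀ v, ∃ a ∈ T, ∃ b ∈ T, FlatAt (cderiv g (v - a) (-b)) 0) : FlatAt g 0 := by
  choose a ha b hb hab using htan
  let A : (E → ℂ) → Prop := fun h => ContDiff ℝ (⊤ : ℕ∞) h ∧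
    (∀ᶠ p in nhdsWithin 0 (T : Set E), h p = 0) ∧ ∀ v, FlatAt (cderiv h (v - a v) (-b v)) 0
  refine flatAt_of_stable (fun f => ∃ h r, A h ∧ ContDiff ℝ (⊤ : ℕ∞) r ∧ FlatAt r 0 ∧
    f = fun x => h x + r x) ?_ ?_ ?_ ⟨g, fun _ => 0, ⟨hg, hT, hab⟩, contDiff_const, ?_, by simp⟩
  · rintro _ ⟨h, r, hA, hr, -, rfl⟩
    exact hA.1.add hr
  · rintro _ ⟨h, r, hA, hr, hr0, rfl⟩
    simp [hr0.apply_eq_zero, hA.2.1.self_of_nhdsWithin T.zero_mem]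
  · rintro _ ⟨h, r, ⟨hs, hz, hf⟩, hr, hr0, rfl⟩ v
    refine ⟨cderiv h (a v) (b v), fun x => cderiv h (v - a v) (-b v) x + cderiv r v 0 x,
      ⟨contDiff_cderiv hs _ _, eventually_cderiv_eq_zero hs hz (ha v) (hb v), fun u => ?_⟩,
      (contDiff_cderiv hs _ _).add (contDiff_cderiv hr _ _),
      (hf v).add (contDiff_cderiv hs _ _) (contDiff_cderiv hr _ _) (hr0.cderiv hr _ _), ?_⟩
    · rw [cderiv_comm hs]
      exact (hf u).cderiv (contDiff_cderiv hs _ _) _ _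
    · funext x
      rw [fderiv_fun_add (hs.differentiable (by simp) x) (hr.differentiable (by simp) x)]
      simp [cderiv]
      ring
  · intro N
    simp

/-- The vectors along which the derivative of `g` agrees, up to a flat function, with a complex
derivative along `T`. -/
def tangentialSubmodule {g : E → ℂ} (hg : ContDiff ℝ (⊤ : ℕ∞) g) (T : Submodule ℝ E) :
    Submodule ℝ E where
  carrier := {v | ∃ a ∈ T, ∃ b ∈ T, FlatAt (cderiv g (v - a) (-b)) 0}
  zero_mem' := ⟨0, T.zero_mem, 0, T.zero_mem, by
    simpa using flatAt_cderiv_zero g 0⟩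
  add_mem' := by
    rintro v w ⟨a, ha, b, hb, h⟩ ⟨c, hc, d, hd, h'⟩
    refine ⟨a + c, T.add_mem ha hc, b + d, T.add_mem hb hd, ?_⟩
    convert h.add (contDiff_cderiv hg _ _) (contDiff_cderiv hg _ _) h' using 1
    funext x
    simp [cderiv]
    ring
  smul_mem' := by
    rintro t v ⟨a, ha, b, hb, h⟩
    refine ⟨t • a, T.smul_mem t ha, t • b, T.smul_mem t hb, ?_⟩
    convert h.const_mul (contDiff_cderiv hg _ _) t using 1
    funext x
    simp [cderiv]
    ring

lemma le_tangentialSubmodule {g : E → ℂ} (hg : ContDiff ℝ (⊤ : ℕ∞) g) (T : Submodule ℝ E) :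
    T ≤ tangentialSubmodule hg T := fun v hv => ⟨v, hv, 0, T.zero_mem, by
  simpa using flatAt_cderiv_zero g 0⟩

/-- If the derivatives of `g` along the complex vectors `e₁ - i f₁` and `e₂ + i f₂` are flat, then
`e₁` and `f₁` are tangential for `g`, where `T` contains `e₁ + e₂` and `f₁ + f₂`. -/
lemma mem_tangentialSubmodule_of_flat {g : E → ℂ} (hg : ContDiff ℝ (⊤ : ℕ∞) g)
    {T : Submodule ℝ E} {e₁ e₂ f₁ f₂ : E} (he : e₁ + e₂ ∈ T) (hf : f₁ + f₂ ∈ T)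
    (h₁ : FlatAt (cderiv g e₁ (-f₁)) 0) (h₂ : FlatAt (cderiv g e₂ f₂) 0) :
    e₁ ∈ tangentialSubmodule hg T ∧ f₁ ∈ tangentialSubmodule hg T := by
  have hs := contDiff_cderiv hg
  have comb (c d : ℂ) : FlatAt (fun x => c * cderiv g e₁ (-f₁) x + d * cderiv g e₂ f₂ x) 0 :=
    (h₁.const_mul (hs _ _) c).add (contDiff_const.mul (hs _ _)) (contDiff_const.mul (hs _ _))
      (h₂.const_mul (hs _ _) d)
  refine ⟨⟨(1 / 2 : ℝ) • (e₁ + e₂), T.smul_mem _ he, (1 / 2 : ℝ) • (f₁ + f₂), T.smul_mem _ hf, ?_⟩,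
    ⟨(1 / 2 : ℝ) • (f₁ + f₂), T.smul_mem _ hf, (-(1 / 2) : ℝ) • (e₁ + e₂), T.smul_mem _ he, ?_⟩⟩
  · convert comb (1 / 2) (-(1 / 2)) using 1
    funext x
    simp [cderiv]
    ring
  · convert comb (Complex.I / 2) (Complex.I / 2) using 1
    funext x
    simp [cderiv]
    ring_nf
    simp
    ring

end FlatFunctions

/-- The diagonal `{(z, z, t)}` as a real subspace. -/
def diagonalSubmodule (n k : ℕ) : Submodule ℝ (Dom n k) where
  carrier := {p | p.1 = p.2.1}
  zero_mem' := rfl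
  add_mem' {p p'} (h : p.1 = p.2.1) (h' : p'.1 = p'.2.1) := by
    change p.1 + p'.1 = p.2.1 + p'.2.1
    rw [h, h']
  smul_mem' t p (h : p.1 = p.2.1) := by
    change t • p.1 = t • p.2.1
    rw [h]

/-- A real subspace containing the diagonal and the coordinate directions of the first factor is
the whole space. -/
lemma mem_of_diagonalSubmodule_le {n k : ℕ} {S : Submodule ℝ (Dom n k)}
    (hT : diagonalSubmodule n k ≤ S)
    (hS : ∀ j : Fin n, ((Pi.single j 1, 0, 0) : Dom n k) ∈ S ∧
      ((Pi.single j Complex.I, 0, 0) : Dom n k) ∈ S) (v : Dom n k) : v ∈ S := by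
  have hz (z : Fin n → ℂ) : ((z, 0, 0) : Dom n k) ∈ S := by
    have : ((z, 0, 0) : Dom n k) = ∑ j, ((z j).re • ((Pi.single j 1, 0, 0) : Dom n k) +
        (z j).im • ((Pi.single j Complex.I, 0, 0) : Dom n k)) := by
      refine Prod.ext ?_ (Prod.ext ?_ ?_)
      · funext i
        simp only [Prod.fst_sum, Finset.sum_apply]
        rw [Finset.sum_eq_single i]
        · simp
        · intro j _ hj
          simp [Pi.single_eq_of_ne hj.symm]
        · simp
      · simp [Prod.snd_sum]
      · simp [Prod.snd_sum]
    rw [this]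
    exact S.sum_mem fun j _ => S.add_mem (S.smul_mem _ (hS j).1) (S.smul_mem _ (hS j).2)
  have hv : v = (v.1 - v.2.1, 0, 0) + (v.2.1, v.2.1, v.2.2) := by
    ext <;> simp
  rw [hv]
  exact S.add_mem (hz _) (hT rfl)

/-- If `g : ℂⁿ × ℂⁿ × ℝᵏ → ℂ` is smooth, the Wirtinger derivatives `∂g/∂z_j`, `∂g/∂w̄_j`
(for `j` among the first `q` indices) and `∂g/∂z̄_j`, `∂g/∂w_j` (for the remaining indices)
vanish to infinite order at the origin, and `g(z, z, t) = 0` near the origin, then `g`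
vanishes to infinite order at the origin. -/
theorem stmt6 {n k : ℕ} (hn : 1 ≤ n) (q : ℕ) (hq : q ≤ n)
    (g : Dom n k → ℂ) (hg : ContDiff ℝ (⊤ : ℕ∞) g)
    (h1 : ∀ j : Fin n, (j : ℕ) < q → FlatAt (dz g j) 0 ∧ FlatAt (dwbar g j) 0)
    (h2 : ∀ j : Fin n, q ≤ (j : ℕ) → FlatAt (dzbar g j) 0 ∧ FlatAt (dw g j) 0)
    (h3 : ∀ᶠ p : (Fin n → ℂ) × (Fin k → ℝ) in nhds 0, g (p.1, p.1, p.2) = 0) :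
    FlatAt g 0 := by
  have hs := contDiff_cderiv hg
  refine flatAt_of_tangential hg (diagonalSubmodule n k) ?_
    (mem_of_diagonalSubmodule_le (le_tangentialSubmodule hg _) fun j => ?_)
  · have hc : Tendsto (fun p : Dom n k => (p.1, p.2.2)) (nhds 0) (nhds 0) := by
      have : Continuous fun p : Dom n k => (p.1, p.2.2) := by fun_prop
      exact this.tendsto 0
    filter_upwards [nhdsWithin_le_nhds (hc.eventually h3), self_mem_nhdsWithin] with p hp hpT
    have hpT : p.1 = p.2.1 := hpT
    have : p = (p.1, p.1, p.2.2) := Prod.ext rfl (Prod.ext hpT.symm rfl)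
    rw [this]
    exact hp
  · have flat_of_half {a b : Dom n k} {f : Dom n k → ℂ} (hf : FlatAt f 0)
        (h : f = fun p => (1 / 2) * cderiv g a b p) : FlatAt (cderiv g a b) 0 := by
      have hf' : FlatAt (fun p => 2 * f p) 0 :=
        hf.const_mul (h ▸ contDiff_const.mul (hs a b)) 2
      convert hf' using 1
      funext p
      simp [h]
    have diag (c : ℂ) : ((Pi.single j c, 0, 0) : Dom n k) + (0, Pi.single j c, 0) ∈
        diagonalSubmodule n k := by
      change (Pi.single j c : Fin n → ℂ) + 0 = 0 + Pi.single j c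
      simp
    rcases lt_or_ge (j : ℕ) q with hj | hj
    · refine mem_tangentialSubmodule_of_flat hg (diag 1) (diag Complex.I)
        (flat_of_half (h1 j hj).1 ?_) (flat_of_half (h1 j hj).2 ?_) <;> funext p
      · rw [dz, cderiv, map_neg]
        ring
      · rfl
    · have h := mem_tangentialSubmodule_of_flat hg (f₁ := -(Pi.single j Complex.I, 0, 0))
        (f₂ := -(0, Pi.single j Complex.I, 0)) (diag 1)
        (by rw [← neg_add]; exact neg_mem (diag Complex.I))
        (flat_of_half (h2 j hj).1 ?_) (flat_of_half (h2 j hj).2 ?_)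
      · exact ⟨h.1, neg_mem_iff.1 h.2⟩
      · funext p
        rw [neg_neg]
        rfl
      · funext p
        rw [dw, cderiv, map_neg]
        ring
end

section
/- Let n ≥ 1, let q ∈ {0, 1, …, n}, let N₀ ∈ ℕ, and let g : ℂⁿ × ℂⁿ → ℂ be a smooth function of the underlying 4n real variables, written g(z, w). Suppose that: (i) for each j with 1 ≤ j ≤ q, every iterated partial derivative of order ≤ N₀ − 1 (with respect to the 4n real coordinates) of ∂g/∂z_j and of ∂g/∂w̄_j vanishes at the origin; (ii) for each j with q+1 ≤ j ≤ n, every iterated partial derivative of order ≤ N₀ − 1 of ∂g/∂z̄_j and of ∂g/∂w_j vanishes at the origin; (iii) every iterated partial derivative of order ≤ N₀ of the diagonal restriction z ↦ g(z, z) vanishes at the origin of ℂⁿ. Then every iterated partial derivative of g of order ≤ N₀ vanishes at the origin of ℂⁿ × ℂⁿ. -/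
/-- The domain `ℂⁿ × ℂⁿ`, viewed as a real normed space. -/
abbrev Dom2 (n : ℕ) : Type := (Fin n → ℂ) × (Fin n → ℂ)

/-- Wirtinger derivative `∂g/∂z_j = (1/2)(∂g/∂x_{2j-1} − i ∂g/∂x_{2j})` in the first
group of complex variables. -/
noncomputable def dz2 {n : ℕ} (g : Dom2 n → ℂ) (j : Fin n) (p : Dom2 n) : ℂ :=
  (1 / 2) * (fderiv ℝ g p (Pi.single j 1, 0) -
    Complex.I * fderiv ℝ g p (Pi.single j Complex.I, 0))

/-- Wirtinger derivative `∂g/∂z̄_j = (1/2)(∂g/∂x_{2j-1} + i ∂g/∂x_{2j})` in the first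
group of complex variables. -/
noncomputable def dzbar2 {n : ℕ} (g : Dom2 n → ℂ) (j : Fin n) (p : Dom2 n) : ℂ :=
  (1 / 2) * (fderiv ℝ g p (Pi.single j 1, 0) +
    Complex.I * fderiv ℝ g p (Pi.single j Complex.I, 0))

/-- Wirtinger derivative `∂g/∂w_j` in the second group of complex variables. -/
noncomputable def dw2 {n : ℕ} (g : Dom2 n → ℂ) (j : Fin n) (p : Dom2 n) : ℂ :=
  (1 / 2) * (fderiv ℝ g p (0, Pi.single j 1) -
    Complex.I * fderiv ℝ g p (0, Pi.single j Complex.I))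

/-- Wirtinger derivative `∂g/∂w̄_j` in the second group of complex variables. -/
noncomputable def dwbar2 {n : ℕ} (g : Dom2 n → ℂ) (j : Fin n) (p : Dom2 n) : ℂ :=
  (1 / 2) * (fderiv ℝ g p (0, Pi.single j 1) +
    Complex.I * fderiv ℝ g p (0, Pi.single j Complex.I))

open Complex in
theorem linearMap_eq_zero_of_cauchyRiemann {n : ℕ} (L : Dom2 n →ₗ[ℝ] ℂ)
    (hd : ∀ u, L (u, u) = 0)
    (hL : ∀ j, (L (Pi.single j 1, 0) - I * L (Pi.single j I, 0) = 0 ∧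
        L (0, Pi.single j 1) + I * L (0, Pi.single j I) = 0) ∨
      (L (Pi.single j 1, 0) + I * L (Pi.single j I, 0) = 0 ∧
        L (0, Pi.single j 1) - I * L (0, Pi.single j I) = 0)) : L = 0 := by
  have split : ∀ u v, L (u, v) = L (u, 0) + L (0, v) := fun u v => by
    rw [← map_add]; simp
  have key : ∀ j, L (Pi.single j 1, 0) = 0 ∧ L (Pi.single j I, 0) = 0 := fun j => by
    have e1 := hd (Pi.single j 1)
    have e2 := hd (Pi.single j I)
    rw [split] at e1 e2
    have hI := I_mul_I
    rcases hL j with ⟨h, h'⟩ | ⟨h, h'⟩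
    · have h0 : L (Pi.single j 1, 0) = 0 := by
        linear_combination (1 / 2) * (e1 + h - h' + I * e2)
      exact ⟨h0, by linear_combination I * h - I * h0 + hI * L (Pi.single j I, 0)⟩
    · have h0 : L (Pi.single j 1, 0) = 0 := by
        linear_combination (1 / 2) * (e1 + h - h' - I * e2)
      exact ⟨h0, by linear_combination -I * h + I * h0 + hI * L (Pi.single j I, 0)⟩
  have hfst : L ∘ₗ LinearMap.inl ℝ _ _ = 0 := by
    refine LinearMap.pi_ext' fun j => Complex.basisOneI.ext fun i => ?_
    fin_cases i
    · simpa using (key j).1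
    · simpa using (key j).2
  have hz : ∀ u, L (u, 0) = 0 := fun u => LinearMap.congr_fun hfst u
  refine LinearMap.ext fun ⟨u, v⟩ => ?_
  have hv := hd v
  rw [split, hz, zero_add] at hv
  rw [split, hz, hv, add_zero, LinearMap.zero_apply]

universe u in
theorem iteratedFDeriv_succ_apply_removeNth {E F : Type u}
    [NormedAddCommGroup E] [NormedSpace ℝ E] [NormedAddCommGroup F] [NormedSpace ℝ F]
    {g : E → F} (hg : ContDiff ℝ (⊤ : ℕ∞) g) (x : E) {N : ℕ}
    (m : Fin (N + 1) → E) (i : Fin (N + 1)) :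
    iteratedFDeriv ℝ (N + 1) g x m =
      iteratedFDeriv ℝ N (fun y => fderiv ℝ g y (m i)) x (i.removeNth m) := by
  induction N generalizing F with
  | zero =>
    obtain rfl := Subsingleton.elim (α := Fin 1) i (Fin.last 0)
    simp [iteratedFDeriv_succ_apply_right]
  | succ k ih =>
    have hd : ContDiff ℝ (⊤ : ℕ∞) (fderiv ℝ g) := hg.fderiv_right (by simp)
    induction i using Fin.lastCases with
    | last =>
      have hA := (ContinuousLinearMap.apply ℝ F (m (Fin.last _))).iteratedFDeriv_comp_left
        (hd.contDiffAt (x := x)) (i := k + 1) (by exact_mod_cast le_top)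
      rw [iteratedFDeriv_succ_apply_right, Fin.removeNth_last]
      exact (congrArg (fun T => T (Fin.init m)) hA).symm
    | cast i =>
      have hsymm : fderiv ℝ (fun y => fderiv ℝ g y (m i.castSucc)) =
          fun y => fderiv ℝ (fderiv ℝ g) y (m i.castSucc) := by
        ext y w
        rw [(hg.contDiffAt.isSymmSndFDerivAt (by
          rw [minSmoothness_of_isRCLikeNormedField]
          exact WithTop.coe_le_coe.2 (le_top (a := (2 : ℕ∞))))).eq,
          fderiv_clm_apply (hd.differentiable (by simp) y) (by fun_prop)]
        simp
      rw [iteratedFDeriv_succ_apply_right, ih hd, iteratedFDeriv_succ_apply_right, hsymm]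
      congr 1
      · congr 1
        ext j
        simp [Fin.removeNth, Fin.init]
      · simp [Fin.removeNth]

theorem iteratedFDeriv_update_add_eq_zero {E : Type} [NormedAddCommGroup E] [NormedSpace ℝ E]
    {g : E → ℂ} (hg : ContDiff ℝ (⊤ : ℕ∞) g) {a b x : E} {c : ℂ} {N : ℕ}
    (h : iteratedFDeriv ℝ N
      (fun p => (1 / 2) * (fderiv ℝ g p a + c * fderiv ℝ g p b)) x = 0)
    (m : Fin (N + 1) → E) (i : Fin (N + 1)) :
    iteratedFDeriv ℝ (N + 1) g x (Function.update m i a) +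
      c * iteratedFDeriv ℝ (N + 1) g x (Function.update m i b) = 0 := by
  have hd : ContDiff ℝ (⊤ : ℕ∞) (fderiv ℝ g) := hg.fderiv_right (by simp)
  have hA (A : (E →L[ℝ] ℂ) →L[ℝ] ℂ) :=
    A.iteratedFDeriv_comp_left (hd.contDiffAt (x := x)) (i := N) (by exact_mod_cast le_top)
  have ha (v : E) : iteratedFDeriv ℝ (N + 1) g x (Function.update m i v) =
      iteratedFDeriv ℝ N (fderiv ℝ g) x (i.removeNth m) v := by
    rw [iteratedFDeriv_succ_apply_removeNth hg x _ i, Function.update_self,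
      Fin.removeNth_update]
    exact congrArg (fun T => T (i.removeNth m)) (hA (ContinuousLinearMap.apply ℝ ℂ v))
  let A : (E →L[ℝ] ℂ) →L[ℝ] ℂ := (1 / 2 : ℂ) •
    (ContinuousLinearMap.apply ℝ ℂ a + c • ContinuousLinearMap.apply ℝ ℂ b)
  have hE : A ∘ fderiv ℝ g =
      fun p => (1 / 2) * (fderiv ℝ g p a + c * fderiv ℝ g p b) := by
    ext p; simp [A, mul_add]
  have hT := hA A
  rw [hE, h] at hT
  have hT' := congrArg (fun T => T (i.removeNth m)) hT
  simp [A] at hT'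
  rw [ha, ha]
  linear_combination -2 * hT'

theorem ContinuousMultilinearMap.eq_zero_of_forall_mem_of_linearMap {R ι E F : Type*}
    [CommSemiring R] [Fintype ι] [DecidableEq ι]
    [AddCommMonoid E] [Module R E] [TopologicalSpace E]
    [AddCommMonoid F] [Module R F] [TopologicalSpace F]
    (T : ContinuousMultilinearMap R (fun _ : ι => E) F) (D : Set E)
    (hD : ∀ m : ι → E, (∀ i, m i ∈ D) → T m = 0)
    (hT : ∀ m i, (∀ u ∈ D, T (Function.update m i u) = 0) → ∀ v, T (Function.update m i v) = 0) :
    T = 0 := by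
  have key : ∀ s : Finset ι, ∀ m : ι → E, (∀ i ∉ s, m i ∈ D) → T m = 0 := by
    intro s
    induction s using Finset.induction_on with
    | empty => exact fun m hm => hD m fun i => hm i (Finset.notMem_empty i)
    | insert i s _ ih =>
      intro m hm
      rw [← Function.update_eq_self i m]
      refine hT m i (fun u hu => ih _ fun k hk => ?_) _
      rcases eq_or_ne k i with rfl | hki
      · simpa using hu
      · simpa [hki] using hm k (by simp [hki, hk])
  ext m
  exact key Finset.univ m (by simp)

/-- Finite-order inductive step: if all iterated partials of order `≤ N₀ − 1` of
`∂g/∂z_j`, `∂g/∂w̄_j` (for the first `q` indices) and of `∂g/∂z̄_j`, `∂g/∂w_j` (for the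
remaining indices) vanish at the origin, and all iterated partials of order `≤ N₀` of
the diagonal restriction `z ↦ g(z,z)` vanish at the origin, then all iterated partials
of `g` of order `≤ N₀` vanish at the origin. -/
theorem stmt7 {n : ℕ} (hn : 1 ≤ n) (q : ℕ) (hq : q ≤ n) (N₀ : ℕ)
    (g : Dom2 n → ℂ) (hg : ContDiff ℝ (⊤ : ℕ∞) g)
    (h1 : ∀ j : Fin n, (j : ℕ) < q → ∀ N : ℕ, N < N₀ →
      iteratedFDeriv ℝ N (dz2 g j) 0 = 0 ∧ iteratedFDeriv ℝ N (dwbar2 g j) 0 = 0)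
    (h2 : ∀ j : Fin n, q ≤ (j : ℕ) → ∀ N : ℕ, N < N₀ →
      iteratedFDeriv ℝ N (dzbar2 g j) 0 = 0 ∧ iteratedFDeriv ℝ N (dw2 g j) 0 = 0)
    (h3 : ∀ N : ℕ, N ≤ N₀ →
      iteratedFDeriv ℝ N (fun z : Fin n → ℂ => g (z, z)) 0 = 0) :
    ∀ N : ℕ, N ≤ N₀ → iteratedFDeriv ℝ N g 0 = 0 := by
  intro N hN
  refine ContinuousMultilinearMap.eq_zero_of_forall_mem_of_linearMap _
    (Set.range fun u : Fin n → ℂ => (u, u)) (fun m hm => ?_) fun m i hu => ?_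
  · choose u hu using hm
    let δ := (ContinuousLinearMap.id ℝ (Fin n → ℂ)).prod (ContinuousLinearMap.id ℝ (Fin n → ℂ))
    have hδ := δ.iteratedFDeriv_comp_right hg 0 (i := N) (by exact_mod_cast le_top)
    have h0 : iteratedFDeriv ℝ N (g ∘ δ) 0 = 0 := h3 N hN
    rw [h0, map_zero] at hδ
    have hu' : m = fun i => δ (u i) := funext fun i => (hu i).symm
    rw [hu']
    exact (congrArg (fun T => T u) hδ).symm
  · obtain _ | k := N
    · exact i.elim0
    let L := (iteratedFDeriv ℝ (k + 1) g 0).toMultilinearMap.toLinearMap m i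
    suffices hL : L = 0 from fun v => LinearMap.congr_fun hL v
    refine linearMap_eq_zero_of_cauchyRiemann L (fun u => hu _ ⟨u, rfl⟩) fun j => ?_
    have hpos := fun (a b : Dom2 n) =>
      iteratedFDeriv_update_add_eq_zero hg (a := a) (b := b) (x := 0) (c := Complex.I)
        (N := k) (m := m) (i := i)
    have hneg := fun (a b : Dom2 n) =>
      iteratedFDeriv_update_add_eq_zero hg (a := a) (b := b) (x := 0) (c := -Complex.I)
        (N := k) (m := m) (i := i)
    simp only [neg_mul, ← sub_eq_add_neg] at hneg
    rcases lt_or_ge (j : ℕ) q with hj | hj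
    · exact Or.inl ⟨hneg _ _ (h1 j hj k hN).1, hpos _ _ (h1 j hj k hN).2⟩
    · exact Or.inr ⟨hpos _ _ (h2 j hj k hN).1, hneg _ _ (h2 j hj k hN).2⟩
end

section
/- Let m ≥ 1 and write points of ℝ^m as x = (x', x_m) with x' ∈ ℝ^{m−1}. Let ψ : ℝ^m × ℝ^{m−1} → ℂ be smooth with ψ(x, x') = 0 for every x ∈ ℝ^m, and set φ(x, y) := −x_m + y_m + ψ(x, y'). Let h, r : ℝ^m × ℝ^m → ℂ be smooth, assume r vanishes to infinite order at every point of the diagonal {(x, x) : x ∈ ℝ^m}, and assume the function g := h·φ + r is independent of y_m (i.e. ∂g/∂y_m ≡ 0). Then both h and g vanish to infinite order at every point of the diagonal. -/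
/-- Points of `ℝᵐ`, written as pairs `(x', x_m)` with `x' ∈ ℝ^{m-1}`. -/
abbrev Pt (m : ℕ) : Type := (Fin (m - 1) → ℝ) × ℝ

section Flatness

variable {E : Type*} [NormedAddCommGroup E] [NormedSpace ℝ E]

theorem ContDiff.fderiv_apply_const {f : E → ℂ} (hf : ContDiff ℝ (⊤ : ℕ∞) f) (e : E) :
    ContDiff ℝ (⊤ : ℕ∞) (fun q => fderiv ℝ f q e) :=
  (hf.fderiv_right (by simp)).clm_apply contDiff_const

theorem iteratedFDeriv_fderiv_apply_eq_zero {f : E → ℂ} (hf : ContDiff ℝ (⊤ : ℕ∞) f)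
    (e p : E) (n : ℕ) (hn : iteratedFDeriv ℝ (n + 1) f p = 0) :
    iteratedFDeriv ℝ n (fun q => fderiv ℝ f q e) p = 0 := by
  have hf' : ContDiff ℝ (⊤ : ℕ∞) (fderiv ℝ f) := hf.fderiv_right (by simp)
  have hle := norm_iteratedFDeriv_clm_apply_const (c := e) (N := (⊤ : ℕ∞))
    (hf'.contDiffAt (x := p)) (n := n) (by exact_mod_cast le_top)
  rw [norm_iteratedFDeriv_fderiv, hn, norm_zero, mul_zero] at hle
  exact norm_le_zero_iff.mp hle

theorem iteratedFDeriv_mul_eq_zero {f g : E → ℂ} (hf : ContDiff ℝ (⊤ : ℕ∞) f)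
    (hg : ContDiff ℝ (⊤ : ℕ∞) g) {p : E} (hfp : f p = 0) {n : ℕ}
    (hgn : ∀ i < n, iteratedFDeriv ℝ i g p = 0) :
    iteratedFDeriv ℝ n (fun q => f q * g q) p = 0 := by
  have hle := norm_iteratedFDeriv_mul_le (N := (⊤ : ℕ∞)) hf hg p (n := n)
    (by exact_mod_cast le_top)
  refine norm_le_zero_iff.mp (hle.trans (Finset.sum_nonpos fun i hi => ?_))
  rcases Nat.eq_zero_or_pos i with rfl | hi0
  · simp [hfp]
  · have := Finset.mem_range.mp hi
    rw [hgn (n - i) (by omega)]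
    simp

/-- A solution of `(c + 1) h + φ ∂ₑh = s`, where `∂ₑφ = 1`, `φ` vanishes at `p` and `s` is flat
at `p`, is flat at `p`. -/
theorem iteratedFDeriv_eq_zero_of_add_mul_fderiv_eq {φ : E → ℂ}
    (hφ : ContDiff ℝ (⊤ : ℕ∞) φ) {e p : E} (hφe : ∀ q, fderiv ℝ φ q e = 1) (hφp : φ p = 0)
    (n c : ℕ) (h s : E → ℂ) (hh : ContDiff ℝ (⊤ : ℕ∞) h) (hs : ContDiff ℝ (⊤ : ℕ∞) s)
    (hsflat : ∀ i, iteratedFDeriv ℝ i s p = 0)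
    (heq : ∀ q, ((c : ℂ) + 1) * h q + φ q * fderiv ℝ h q e = s q) :
    iteratedFDeriv ℝ n h p = 0 := by
  induction n using Nat.strong_induction_on generalizing c h s with
  | _ n ih =>
    have hd := hh.fderiv_apply_const e
    have hds := hs.fderiv_apply_const e
    have hdiff {f : E → ℂ} (hf : ContDiff ℝ (⊤ : ℕ∞) f) (q : E) : DifferentiableAt ℝ f q :=
      hf.differentiable (by simp) q
    have hdflat : ∀ i < n, iteratedFDeriv ℝ i (fun q => fderiv ℝ h q e) p = 0 := by
      intro i hi
      refine ih i hi (c + 1) _ (fun q => fderiv ℝ s q e) hd hds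
        (fun j => iteratedFDeriv_fderiv_apply_eq_zero hs e p j (hsflat _)) fun q => ?_
      have hsum := (((hdiff hh q).hasFDerivAt.const_mul ((c : ℂ) + 1)).add
        ((hdiff hφ q).hasFDerivAt.mul (hdiff hd q).hasFDerivAt)).congr_of_eventuallyEq
        (Filter.Eventually.of_forall fun q => (heq q).symm)
      have := congrArg (fun L => L e) hsum.fderiv
      simp [hφe] at this
      simp only [this]
      push_cast
      ring
    have hprod := iteratedFDeriv_mul_eq_zero hφ hd hφp hdflat
    have hc : (c : ℂ) + 1 ≠ 0 := by exact_mod_cast c.succ_ne_zero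
    have hrep : h = ((c : ℂ) + 1)⁻¹ • (s - fun q => φ q * fderiv ℝ h q e) := by
      funext q
      simp only [Pi.smul_apply, Pi.sub_apply, smul_eq_mul, ← heq q]
      field_simp
      ring
    have hN : ((n : ℕ∞) : WithTop ℕ∞) ≤ ((⊤ : ℕ∞) : WithTop ℕ∞) := by exact_mod_cast le_top
    have hsn : ContDiffAt ℝ n s p := (hs.of_le hN).contDiffAt
    have hpn : ContDiffAt ℝ n (fun q => φ q * fderiv ℝ h q e) p :=
      ((hφ.mul hd).of_le hN).contDiffAt
    rw [hrep, iteratedFDeriv_const_smul_apply (f := s - fun q => φ q * fderiv ℝ h q e)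
      (hsn.sub hpn), iteratedFDeriv_sub_apply hsn hpn,
      hsflat, hprod, sub_zero, smul_zero]

end Flatness

/-- If `φ(x,y) = −x_m + y_m + ψ(x, y')` with `ψ` smooth and `ψ(x, x') = 0`, `r` vanishes
to infinite order at every diagonal point, and `g = h·φ + r` is independent of `y_m`,
then both `h` and `g` vanish to infinite order at every diagonal point. -/
theorem stmt8 {m : ℕ} (hm : 1 ≤ m)
    (ψ : Pt m × (Fin (m - 1) → ℝ) → ℂ) (hψ : ContDiff ℝ (⊤ : ℕ∞) ψ)
    (hψ0 : ∀ x : Pt m, ψ (x, x.1) = 0)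
    (h r : Pt m × Pt m → ℂ)
    (hh : ContDiff ℝ (⊤ : ℕ∞) h) (hr : ContDiff ℝ (⊤ : ℕ∞) r)
    (hrflat : ∀ x : Pt m, ∀ N : ℕ, iteratedFDeriv ℝ N r (x, x) = 0)
    (φ : Pt m × Pt m → ℂ)
    (hφ : ∀ p : Pt m × Pt m, φ p = -(p.1.2 : ℂ) + (p.2.2 : ℂ) + ψ (p.1, p.2.1))
    (g : Pt m × Pt m → ℂ)
    (hgdef : ∀ p : Pt m × Pt m, g p = h p * φ p + r p)
    (hgindep : ∀ p : Pt m × Pt m, fderiv ℝ g p (0, 0, 1) = 0) :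
    ∀ x : Pt m, ∀ N : ℕ,
      iteratedFDeriv ℝ N h (x, x) = 0 ∧ iteratedFDeriv ℝ N g (x, x) = 0 := by
  have hφs : ContDiff ℝ (⊤ : ℕ∞) φ := by
    rw [funext hφ]
    have h1 : ContDiff ℝ (⊤ : ℕ∞) (fun p : Pt m × Pt m => (p.1.2 : ℂ)) :=
      Complex.ofRealCLM.contDiff.comp (contDiff_snd.comp contDiff_fst)
    have h2 : ContDiff ℝ (⊤ : ℕ∞) (fun p : Pt m × Pt m => (p.2.2 : ℂ)) :=
      Complex.ofRealCLM.contDiff.comp (contDiff_snd.comp contDiff_snd)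
    exact (h1.neg.add h2).add
      (hψ.comp (contDiff_fst.prodMk (contDiff_fst.comp contDiff_snd)))
  have hdiff {f : Pt m × Pt m → ℂ} (hf : ContDiff ℝ (⊤ : ℕ∞) f) (q : Pt m × Pt m) :
      DifferentiableAt ℝ f q := hf.differentiable (by simp) q
  set e : Pt m × Pt m := (0, 0, 1) with he
  have hφe : ∀ q, fderiv ℝ φ q e = 1 := by
    intro q
    have hline : ∀ t : ℝ, φ (q + t • e) = φ q + (t : ℂ) := by
      intro t
      simp [hφ, he]
      ring
    have h1 : HasDerivAt (fun t : ℝ => φ q + (t : ℂ)) 1 0 :=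
      (Complex.ofRealCLM.hasDerivAt (x := (0 : ℝ))).const_add _
    rw [← (hdiff hφs q).lineDeriv_eq_fderiv, lineDeriv, funext hline, h1.deriv]
  intro x
  have hφp : φ (x, x) = 0 := by simp [hφ, hψ0]
  have hhflat (n : ℕ) : iteratedFDeriv ℝ n h (x, x) = 0 := by
    refine iteratedFDeriv_eq_zero_of_add_mul_fderiv_eq hφs hφe hφp n 0 h
      (fun q => fderiv ℝ (-r) q e) hh (hr.neg.fderiv_apply_const e) (fun i =>
        iteratedFDeriv_fderiv_apply_eq_zero hr.neg e _ i ?_) fun q => ?_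
    · change iteratedFDeriv ℝ (i + 1) (-r) (x, x) = 0
      rw [iteratedFDeriv_neg_apply, hrflat, neg_zero]
    · have hsum := (((hdiff hh q).hasFDerivAt.mul (hdiff hφs q).hasFDerivAt).add
        (hdiff hr q).hasFDerivAt).congr_of_eventuallyEq
        (Filter.Eventually.of_forall hgdef)
      have := hgindep q
      rw [hsum.fderiv] at this
      simp [hφe] at this
      simp only [fderiv_neg, neg_apply, Nat.cast_zero]
      linear_combination this
  intro N
  refine ⟨hhflat N, ?_⟩
  have hN : ((N : ℕ∞) : WithTop ℕ∞) ≤ ((⊤ : ℕ∞) : WithTop ℕ∞) := by exact_mod_cast le_top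
  have hg : g = (fun q => φ q * h q) + r := by
    funext q
    simp [hgdef, mul_comm]
  rw [hg, iteratedFDeriv_add_apply ((hφs.mul hh).of_le hN).contDiffAt (hr.of_le hN).contDiffAt,
    hrflat, iteratedFDeriv_mul_eq_zero hφs hh hφp fun i _ => hhflat i, add_zero]
end
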